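/- arXiv:math/0612219 — 2 statements merged into one kernel-verified Lean document; each statement's English description precedes it below -/
import Mathlib

section
/- For any wide subcategory A of rep Q, one has A = a(Gen A); that is, an object B lies in A if and only if B ∈ Gen A and every morphism g : y → B with y ∈ Gen A has kernel in Gen A. -/
open CategoryTheory CategoryTheory.Limits ZeroObject

attribute [local instance] CategoryTheory.Abelian.hasFiniteBiproducts

noncomputable section

namespace NCPaper

/-- A finite quiver without oriented cycles. -/
structure FinQuiver : Type 1 where
  V : Type
  [quiver : Quiver.{0} V]
  [fintypeV : Fintype V]
  [fintypeArr : ∀ a b : V, Fintype (a ⟶ b)]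
  acyclic : ∀ (v : V) (p : Quiver.Path v v), p = Quiver.Path.nil

attribute [instance] FinQuiver.quiver FinQuiver.fintypeV FinQuiver.fintypeArr

variable (k : Type) [Field k] (Q : FinQuiver)

/-- The ambient abelian category of all `k`-linear representations of `Q`;
finite-dimensional representations are singled out by the predicate `FinDim`. -/
abbrev RepC : Type 1 := Paths Q.V ⥤ ModuleCat.{0} k

variable {k Q}

/-- `M` is a finite-dimensional representation, i.e. an object of `rep Q`. -/
def FinDim (M : RepC k Q) : Prop :=
  ∀ v : Q.V, FiniteDimensional k (M.obj ((Paths.of Q.V).obj v))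

section Cat

variable {C : Type*} [Category C] [Abelian C]

/-- `X` is a direct summand of `A`. -/
def IsSummand (X A : C) : Prop := ∃ (i : X ⟶ A) (r : A ⟶ X), i ≫ r = 𝟙 X

/-- The additive closure of a set of objects: direct summands of finite direct sums. -/
def addSet (S : Set C) : Set C :=
  { X | ∃ (n : ℕ) (f : Fin n → C), (∀ i, f i ∈ S) ∧ IsSummand X (⨁ f) }

/-- `Gen S`: all quotients of objects of the additive closure of `S`. -/
def gen (S : Set C) : Set C := { X | ∃ A ∈ addSet S, ∃ p : A ⟶ X, Epi p }

/-- All morphisms from `A` to `B` vanish. -/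
def HomZero (A B : C) : Prop := ∀ f : A ⟶ B, f = 0

/-- `Ext¹(A, B) = 0`, expressed by the splitting of all short exact sequences
`0 ⟶ B ⟶ E ⟶ A ⟶ 0`. -/
def Ext1Zero (A B : C) : Prop :=
  ∀ (E : C) (i : B ⟶ E) (p : E ⟶ A) (w : i ≫ p = 0),
    (ShortComplex.mk i p w).ShortExact → ∃ r : E ⟶ B, i ≫ r = 𝟙 B

/-- An indecomposable object. -/
def Indec (X : C) : Prop :=
  ¬ IsZero X ∧ ∀ (A B : C), (X ≅ A ⊞ B) → IsZero A ∨ IsZero B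

/-- A torsion class: a full subcategory (identified with its set of objects) closed under
direct sums, direct summands, quotients and extensions. -/
structure IsTorsionClass (T : Set C) : Prop where
  zero_mem : (0 : C) ∈ T
  sum_mem : ∀ X ∈ T, ∀ Y ∈ T, (X ⊞ Y : C) ∈ T
  summand_mem : ∀ X ∈ T, ∀ Y : C, IsSummand Y X → Y ∈ T
  quot_mem : ∀ X ∈ T, ∀ (Y : C) (p : X ⟶ Y), Epi p → Y ∈ T
  ext_mem : ∀ S : ShortComplex C, S.ShortExact → S.X₁ ∈ T → S.X₃ ∈ T → S.X₂ ∈ T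

/-- A wide subcategory: a full subcategory (closed under direct sums and summands)
which is exact abelian (closed under kernels and cokernels) and closed under extensions. -/
structure IsWide (A : Set C) : Prop where
  zero_mem : (0 : C) ∈ A
  sum_mem : ∀ X ∈ A, ∀ Y ∈ A, (X ⊞ Y : C) ∈ A
  summand_mem : ∀ X ∈ A, ∀ Y : C, IsSummand Y X → Y ∈ A
  ker_mem : ∀ X ∈ A, ∀ Y ∈ A, ∀ f : X ⟶ Y, (kernel f : C) ∈ A
  coker_mem : ∀ X ∈ A, ∀ Y ∈ A, ∀ f : X ⟶ Y, (cokernel f : C) ∈ A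
  ext_mem : ∀ S : ShortComplex C, S.ShortExact → S.X₁ ∈ A → S.X₃ ∈ A → S.X₂ ∈ A

/-- `P` is split projective in the subcategory `T`: every epimorphism onto `P`
from an object of `T` splits. -/
def SplitProjIn (T : Set C) (P : C) : Prop :=
  P ∈ T ∧ ∀ X ∈ T, ∀ p : X ⟶ P, Epi p → ∃ s : P ⟶ X, s ≫ p = 𝟙 P

/-- `P` is Ext-projective in the subcategory `T`. -/
def ExtProjIn (T : Set C) (P : C) : Prop := P ∈ T ∧ ∀ X ∈ T, Ext1Zero P X

/-- The subcategory `a(T)` associated to a torsion class `T`. -/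
def aSet (T : Set C) : Set C :=
  { B | B ∈ T ∧ ∀ Y ∈ T, ∀ g : Y ⟶ B, (kernel g : C) ∈ T }

/-- A subcategory is finitely generated if it is generated by a single object of it. -/
def IsFinGen (T : Set C) : Prop := ∃ U ∈ T, T ⊆ gen {U}

/-- `U` is a generator of the subcategory `T`. -/
def IsGenerator (T : Set C) (U : C) : Prop := U ∈ T ∧ T ⊆ gen {U}

/-- `X` is a subquotient of `M`. -/
def IsSubquotient (X M : C) : Prop := ∃ (N : C) (i : N ⟶ M) (p : N ⟶ X), Mono i ∧ Epi p

/-- The support of `M` is contained in the support of `C0`: every simple subquotient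
(composition factor) of `M` is a composition factor of `C0`. -/
def SuppLE (M C0 : C) : Prop := ∀ S : C, Simple S → IsSubquotient S M → IsSubquotient S C0

/-- A partial tilting object of a hereditary category. -/
def IsPartialTilting (T : C) : Prop := Ext1Zero T T

/-- `T` is a tilting object of the full subcategory `A`: it is self-orthogonal and every
(split) projective object of `A` admits a coresolution `0 ⟶ P ⟶ T' ⟶ T'' ⟶ 0` with
`T', T'' ∈ add T`. For `A` the subcategory of representations supported on `supp T`,
this says exactly that `T` is a tilting `kQ/ann T`-module. -/
def TiltingIn (A : Set C) (T : C) : Prop :=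
  T ∈ A ∧ Ext1Zero T T ∧
    ∀ P : C, SplitProjIn A P →
      ∃ (T' T'' : C) (_ : T' ∈ addSet {T}) (_ : T'' ∈ addSet {T})
        (i : P ⟶ T') (p : T' ⟶ T'') (w : i ≫ p = 0),
        (ShortComplex.mk i p w).ShortExact


/-- `U` is the direct sum of one representative of each isomorphism class of
indecomposable Ext-projective objects of `T`. -/
def IsExtProjSum (T : Set C) (U : C) : Prop :=
  ∃ (n : ℕ) (f : Fin n → C),
    (∀ i, Indec (f i) ∧ ExtProjIn T (f i)) ∧
    (∀ i j, Nonempty (f i ≅ f j) → i = j) ∧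
    (∀ P : C, Indec P → ExtProjIn T P → ∃ i, Nonempty (P ≅ f i)) ∧
    Nonempty (U ≅ ⨁ f)

/-- A basic object: a direct sum of pairwise non-isomorphic indecomposables. -/
def IsBasic (U : C) : Prop :=
  ∃ (n : ℕ) (f : Fin n → C), (∀ i, Indec (f i)) ∧
    (∀ i j, Nonempty (f i ≅ f j) → i = j) ∧ Nonempty (U ≅ ⨁ f)

end Cat

/-- A support tilting object of `rep Q`: partial tilting, and tilting as a
`kQ/ann T`-module, i.e. tilting in the subcategory of all finite-dimensional
representations supported on the support of `T`. -/
def IsSupportTilting {k : Type} [Field k] {Q : FinQuiver} (T : RepC k Q) : Prop :=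
  IsPartialTilting T ∧ TiltingIn { M : RepC k Q | FinDim M ∧ SuppLE M T } T

section Comb

/-- The dimension vector of a representation. -/
def dimVec {k : Type} [Field k] {Q : FinQuiver} (M : RepC k Q) : Q.V → ℤ :=
  fun v => (Module.finrank k (M.obj ((Paths.of Q.V).obj v)) : ℤ)

/-- The Euler form of the quiver `Q`. -/
def euler (Q : FinQuiver) {R : Type} [CommRing R] (α β : Q.V → R) : R :=
  (∑ v : Q.V, α v * β v) - ∑ a : (Σ x : Q.V, Σ y : Q.V, x ⟶ y), α a.1 * β a.2.1

/-- The symmetrized Euler form of the quiver `Q`. -/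
def symEuler (Q : FinQuiver) {R : Type} [CommRing R] (α β : Q.V → R) : R :=
  euler Q α β + euler Q β α

/-- The reflection in the vector `v`: `s_v(w) = w - (v, w)·v`. -/
def reflV (Q : FinQuiver) (v : Q.V → ℤ) : (Q.V → ℤ) → (Q.V → ℤ) :=
  fun w => w - symEuler Q v w • v

/-- The composition (product, written from left to right) of a finite sequence of
linear transformations. -/
def comps (Q : FinQuiver) {m : ℕ} (g : Fin m → ((Q.V → ℤ) → (Q.V → ℤ))) :
    (Q.V → ℤ) → (Q.V → ℤ) :=
  (List.ofFn g).foldr (· ∘ ·) id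

open scoped Classical in
/-- The simple root at a vertex. -/
def simRoot (Q : FinQuiver) (v : Q.V) : Q.V → ℤ := fun w => if w = v then 1 else 0

/-- The simple reflection at a vertex. -/
def sref (Q : FinQuiver) (v : Q.V) : (Q.V → ℤ) → (Q.V → ℤ) := reflV Q (simRoot Q v)

/-- An enumeration of the vertices is compatible with the arrows of `Q` if sources
of arrows come before targets. -/
def OrdCompatible (Q : FinQuiver) (ord : Fin (Fintype.card Q.V) ≃ Q.V) : Prop :=
  ∀ (x y : Q.V), (x ⟶ y) → ord.symm x < ord.symm y

/-- The Coxeter element `cox(Q)`: the product of the simple reflections from left to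
right in an order compatible with the arrows of `Q`. -/
def coxeter (Q : FinQuiver) (ord : Fin (Fintype.card Q.V) ≃ Q.V) :
    (Q.V → ℤ) → (Q.V → ℤ) :=
  comps Q fun i => sref Q (ord i)

/-- The product of the simple reflections indexed by a word (a list of vertices). -/
def wordProd (Q : FinQuiver) (l : List Q.V) : (Q.V → ℤ) → (Q.V → ℤ) :=
  (l.map (sref Q)).foldr (· ∘ ·) id

/-- Membership in the Coxeter group `W` (realized faithfully on the root lattice). -/
def InW (Q : FinQuiver) (w : (Q.V → ℤ) → (Q.V → ℤ)) : Prop :=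
  ∃ l : List Q.V, w = wordProd Q l

/-- The reflections of `W`: the conjugates of the simple reflections. -/
def IsRefl (Q : FinQuiver) (t : (Q.V → ℤ) → (Q.V → ℤ)) : Prop :=
  ∃ (l : List Q.V) (i : Q.V), t = wordProd Q l ∘ sref Q i ∘ wordProd Q l.reverse

/-- The absolute length: the least length of an expression as a product of reflections. -/
def ellT (Q : FinQuiver) (w : (Q.V → ℤ) → (Q.V → ℤ)) : ℕ :=
  sInf { m | ∃ f : Fin m → ((Q.V → ℤ) → (Q.V → ℤ)), (∀ i, IsRefl Q (f i)) ∧ w = comps Q f }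

/-- The absolute order on `W`. -/
def absLe (Q : FinQuiver) : ((Q.V → ℤ) → (Q.V → ℤ)) → ((Q.V → ℤ) → (Q.V → ℤ)) → Prop :=
  Relation.ReflTransGen fun u v => ∃ t, IsRefl Q t ∧ v = u ∘ t ∧ ellT Q v = ellT Q u + 1

/-- The noncrossing partitions `NC_Q`: the interval `[e, cox(Q)]` in absolute order. -/
def NCSet (Q : FinQuiver) (ord : Fin (Fintype.card Q.V) ≃ Q.V) :
    Set ((Q.V → ℤ) → (Q.V → ℤ)) :=
  { w | InW Q w ∧ absLe Q w (coxeter Q ord) }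

/-- `Q` is of finite (Dynkin) type: the symmetrized Euler form is positive definite. -/
def FiniteType (Q : FinQuiver) : Prop :=
  ∀ α : Q.V → ℚ, α ≠ 0 → 0 < symEuler Q α α

/-- `Q` is of affine (extended Dynkin) type: the symmetrized Euler form is positive
semidefinite with nontrivial radical. -/
def AffineType (Q : FinQuiver) : Prop :=
  (∀ α : Q.V → ℚ, 0 ≤ symEuler Q α α) ∧ ∃ α : Q.V → ℚ, α ≠ 0 ∧ symEuler Q α α = 0

end Comb

section Helpers

variable {C : Type*} [Category C] [Abelian C]

theorem helper_biproduct_mem {A : Set C} (hA : IsWide A) :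
    ∀ (n : ℕ) (f : Fin n → C), (∀ i, f i ∈ A) → (⨁ f) ∈ A := by
  intro n
  induction n with
  | zero =>
    intro f _
    refine hA.summand_mem 0 hA.zero_mem _ ⟨0, 0, ?_⟩
    apply biproduct.hom_ext
    intro j
    exact j.elim0
  | succ n ih =>
    intro f hf
    refine hA.summand_mem _ (hA.sum_mem _ (hf 0) _ (ih (fun j => f j.succ) fun j => hf j.succ)) _
      ⟨biprod.lift (biproduct.π f 0) (biproduct.lift fun j : Fin n => biproduct.π f j.succ),
       biprod.desc (biproduct.ι f 0) (biproduct.desc fun j : Fin n => biproduct.ι f j.succ), ?_⟩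
    rw [biprod.lift_desc, biproduct.lift_desc, ← biproduct.total, Fin.sum_univ_succ]

theorem helper_gen {A : Set C} (hA : IsWide A) {X : C} (hX : X ∈ gen A) :
    ∃ Y ∈ A, ∃ p : Y ⟶ X, Epi p := by
  obtain ⟨Y, ⟨n, f, hf, hs⟩, p, hp⟩ := hX
  exact ⟨Y, hA.summand_mem _ (helper_biproduct_mem hA n f hf) _ hs, p, hp⟩

theorem helper_mem_gen {A : Set C} {X Y : C} (hY : Y ∈ A) (p : Y ⟶ X) (hp : Epi p) :
    X ∈ gen A := by
  refine ⟨Y, ⟨1, fun _ => Y, fun _ => hY,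
    biproduct.ι (fun _ : Fin 1 => Y) 0, biproduct.π (fun _ : Fin 1 => Y) 0, by simp⟩, p, hp⟩

theorem helper_main {A : Set C} (hA : IsWide A) : aSet (gen A) = A := by
  ext B
  constructor
  · rintro ⟨hB, hk⟩
    obtain ⟨Y, hY, p, hp⟩ := helper_gen hA hB
    obtain ⟨Z, hZ, q, hq⟩ := helper_gen hA (hk Y (helper_mem_gen hY (𝟙 Y) inferInstance) p)
    have hc := hA.coker_mem Z hZ Y hY (q ≫ kernel.ι p)
    refine hA.summand_mem _ hc _ ?_
    let e : cokernel (q ≫ kernel.ι p) ≅ B :=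
      cokernelEpiComp q (kernel.ι p) ≪≫
        ((Abelian.epiIsCokernelOfKernel _ (kernelIsKernel p)).coconePointUniqueUpToIso
          (cokernelIsCokernel (kernel.ι p))).symm
    exact ⟨e.inv, e.hom, e.inv_hom_id⟩
  · intro hB
    refine ⟨helper_mem_gen hB (𝟙 B) inferInstance, fun Y hY g => ?_⟩
    obtain ⟨X, hX, p, hp⟩ := helper_gen hA hY
    have hsq : IsPullback (kernel.map (p ≫ g) g p (𝟙 B) (by simp)) (kernel.ι (p ≫ g))
        (kernel.ι g) p := by
      refine IsPullback.of_isLimit' ⟨by simp⟩ (PullbackCone.IsLimit.mk _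
        (fun s => kernel.lift _ s.snd ?_) ?_ ?_ ?_)
      · rw [← Category.assoc, ← s.condition, Category.assoc, kernel.condition, comp_zero]
      · intro s
        rw [← cancel_mono (kernel.ι g)]
        simp [s.condition]
      · intro s; simp
      · intro s m _ h2
        rw [← cancel_mono (kernel.ι (p ≫ g))]
        simp [h2]
    exact helper_mem_gen (hA.ker_mem X hX B hB (p ≫ g)) _
      (Abelian.epi_fst_of_isLimit _ _ hsq.isLimit)

end Helpers

section Statement6

/-- For any wide subcategory `A` of `rep Q` one has `A = a(Gen A)`:
an object `B` lies in `A` if and only if `B ∈ Gen A` and every morphism `g : Y ⟶ B`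
with `Y ∈ Gen A` has kernel in `Gen A`. -/
theorem statement6 (k : Type) [Field k] [IsAlgClosed k] (Q : FinQuiver)
    (A : Set (RepC k Q)) (hA : IsWide A) (hfd : ∀ X ∈ A, FinDim X) :
    aSet (gen A) = A := by
  exact helper_main hA

end Statement6
end NCPaper
end
end

section
/- If T is a finitely generated torsion class in rep Q, then a(T) is a finitely generated wide subcategory, Gen a(T) = T, and the projective objects of the abelian category a(T) are exactly the T-split projective objects. Consequently, the maps T ↦ a(T) and A ↦ Gen A are mutually inverse bijections between finitely generated torsion classes in rep Q and finitely generated wide subcategories of rep Q. -/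
open CategoryTheory CategoryTheory.Limits ZeroObject

attribute [local instance] CategoryTheory.Abelian.hasFiniteBiproducts

noncomputable section

namespace NCPaper

variable (k : Type) [Field k] (Q : FinQuiver)

variable {k Q}

section LA

theorem exists_idem_of_not_nilp {k A : Type*} [Field k] [Ring A] [Algebra k A]
    [Module.Finite k A] (y : A) (hy : ¬ IsNilpotent y) :
    ∃ g : Polynomial k, IsIdempotentElem (y * Polynomial.aeval y g) ∧
      y * Polynomial.aeval y g ≠ 0 := by
  have hint : IsIntegral k y := IsIntegral.of_finite k y
  obtain ⟨q, hq, hnd⟩ := Polynomial.exists_eq_pow_rootMultiplicity_mul_and_not_dvd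
    (minpoly k y) (minpoly.ne_zero hint) 0
  set n := (minpoly k y).rootMultiplicity 0
  have hX : (Polynomial.X - Polynomial.C (0 : k)) = Polynomial.X := by simp
  rw [hX] at hq hnd
  have hc : IsCoprime (Polynomial.X ^ (n + 1) : Polynomial k) q :=
    ((Polynomial.irreducible_X.coprime_iff_not_dvd).2 hnd).pow_left
  obtain ⟨a, b, hab⟩ := hc
  have h0 : Polynomial.aeval y (Polynomial.X ^ n * q) = 0 := by
    rw [← hq]; exact minpoly.aeval k y
  refine ⟨Polynomial.X ^ n * a, ?_, ?_⟩
  all_goals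
    have hf : y * Polynomial.aeval y (Polynomial.X ^ n * a)
      = Polynomial.aeval y (a * Polynomial.X ^ (n + 1)) := by
      rw [show a * Polynomial.X ^ (n + 1) = Polynomial.X * (Polynomial.X ^ n * a) by ring]
      rw [map_mul (Polynomial.aeval y) Polynomial.X, Polynomial.aeval_X]
  · rw [hf]
    unfold IsIdempotentElem
    rw [← map_mul]
    have : a * Polynomial.X ^ (n + 1) * (a * Polynomial.X ^ (n + 1))
      = a * Polynomial.X ^ (n + 1) - (Polynomial.X ^ n * q) * (a * b * Polynomial.X) := by
      have : a * Polynomial.X ^ (n + 1) = 1 - b * q := by rw [← hab]; ring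
      calc _ = a * Polynomial.X ^ (n + 1) * (1 - b * q) := by rw [← this]
        _ = _ := by ring
    rw [this, map_sub, map_mul _ (Polynomial.X ^ n * q), h0, zero_mul, sub_zero]
  · rw [hf]
    intro hz
    apply hy
    refine ⟨n, ?_⟩
    have : (Polynomial.X ^ n : Polynomial k)
      = Polynomial.X ^ n * (a * Polynomial.X ^ (n + 1)) + (Polynomial.X ^ n * q) * b := by
      calc (Polynomial.X ^ n : Polynomial k) = Polynomial.X ^ n * 1 := by ring
        _ = Polynomial.X ^ n * (a * Polynomial.X ^ (n + 1) + b * q) := by rw [hab]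
        _ = _ := by ring
    have h2 := congrArg (Polynomial.aeval y) this
    rw [map_add, map_mul, hz, map_mul _ (Polynomial.X ^ n * q), h0] at h2
    simpa using h2

theorem la_main {k W : Type*} [Field k] [AddCommGroup W] [Module k W] [Module.Finite k W]
    (R : Type*) [Ring R] [Algebra k R] [Module.Finite k R] [Module R W] [IsScalarTower k R W]
    [FaithfulSMul R W] (n : ℕ) (p : Fin n → R)
    (hp : ∀ M : Submodule R W, (∀ i w, p i • w ∈ M) → M = ⊤)
    (hmin : ∀ e : R, IsIdempotentElem e →
      Submodule.span R (Set.range fun w : W => e • w) = ⊤ → e = 1) :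
    ∃ r : Fin n → R, ∑ i, p i * r i = 1 := by
  classical
  let I : Set R := {x | ∃ r : Fin n → R, ∑ i, p i * r i = x}
  have I_add : ∀ x ∈ I, ∀ y ∈ I, x + y ∈ I := by
    rintro _ ⟨r, rfl⟩ _ ⟨s, rfl⟩
    exact ⟨r + s, by simp [mul_add, Finset.sum_add_distrib]⟩
  have I_mul : ∀ x ∈ I, ∀ y : R, x * y ∈ I := by
    rintro _ ⟨r, rfl⟩ y
    exact ⟨fun i => r i * y, by simp [Finset.sum_mul, mul_assoc]⟩
  have I_sub : ∀ x ∈ I, ∀ y ∈ I, x - y ∈ I := by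
    intro x hx y hy
    have := I_add x hx _ (I_mul y hy (-1))
    rwa [mul_neg, mul_one, ← sub_eq_add_neg] at this
  have I_p : ∀ i, p i ∈ I := fun i => ⟨Pi.single i 1, by
    rw [Finset.sum_eq_single i] <;> simp +contextual⟩
  have I_0 : (0 : R) ∈ I := ⟨0, by simp⟩
  -- idempotent of maximal rank
  let rk : R → ℕ := fun e => Module.finrank k (LinearMap.range (Algebra.lsmul k k W e))
  obtain ⟨e, ⟨heI, hei⟩, hemax⟩ : ∃ e : R, (e ∈ I ∧ IsIdempotentElem e) ∧
      ∀ f : R, f ∈ I ∧ IsIdempotentElem f → rk f ≤ rk e := by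
    have hwf : ∃ e ∈ {e | e ∈ I ∧ IsIdempotentElem e}, ∀ f ∈ {e | e ∈ I ∧ IsIdempotentElem e},
        ¬ (Module.finrank k W - rk f < Module.finrank k W - rk e) :=
      (InvImage.wf (fun e : R => Module.finrank k W - rk e) Nat.lt_wfRel.wf).has_min _
        ⟨0, I_0, IsIdempotentElem.zero⟩
    obtain ⟨e, he, h⟩ := hwf
    refine ⟨e, he, fun f hf => ?_⟩
    have h1 := h f hf
    have h2 : rk f ≤ Module.finrank k W := Submodule.finrank_le _
    have h3 : rk e ≤ Module.finrank k W := Submodule.finrank_le _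
    omega
  have hee : e * e = e := hei
  -- nilpotency
  have hnil : ∀ x ∈ I, IsNilpotent ((1 - e) * x * (1 - e)) := by
    intro x hx
    by_contra hn
    obtain ⟨g, hfi, hf0⟩ := exists_idem_of_not_nilp (k := k) _ hn
    set y := (1 - e) * x * (1 - e) with hy
    have hyI : y ∈ I := by
      rw [hy, sub_mul, one_mul]
      exact I_mul _ (I_sub _ hx _ (I_mul _ heI _)) _
    have hey : e * y = 0 := by
      rw [hy, ← mul_assoc, ← mul_assoc, show e * (1 - e) = 0 by rw [mul_sub, mul_one, hee, sub_self],
        zero_mul, zero_mul]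
    have hye : y * e = 0 := by
      rw [hy, mul_assoc _ _ e, show (1 - e) * e = 0 by rw [sub_mul, one_mul, hee, sub_self],
        mul_zero]
    set f := y * Polynomial.aeval y g with hf
    have hfI : f ∈ I := I_mul _ hyI _
    have hff : f * f = f := hfi
    have hef : e * f = 0 := by rw [hf, ← mul_assoc, hey, zero_mul]
    have hfe : f * e = 0 := by
      have : f = Polynomial.aeval y g * y := by
        rw [hf]
        have h1 : y = Polynomial.aeval y (Polynomial.X : Polynomial k) := by simp
        calc y * Polynomial.aeval y g
            = Polynomial.aeval y (Polynomial.X : Polynomial k) * Polynomial.aeval y g := by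
              rw [← h1]
          _ = Polynomial.aeval y g * Polynomial.aeval y (Polynomial.X : Polynomial k) := by
              rw [← map_mul, ← map_mul, mul_comm]
          _ = _ := by rw [← h1]
      rw [this, mul_assoc, hye, mul_zero]
    have hidem : IsIdempotentElem (e + f) := by
      unfold IsIdempotentElem
      rw [add_mul, mul_add, mul_add, hee, hef, hfe, hff, add_zero, zero_add]
    have hle := hemax (e + f) ⟨I_add _ heI _ hfI, hidem⟩
    have hlt : LinearMap.range (Algebra.lsmul k k W e) < LinearMap.range (Algebra.lsmul k k W (e + f)) := by
      refine lt_of_le_of_ne ?_ ?_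
      · rintro _ ⟨w, rfl⟩
        refine ⟨(Algebra.lsmul k k W e) w, ?_⟩
        have : (e + f) * e = e := by rw [add_mul, hee, hfe, add_zero]
        simp only [Algebra.lsmul_coe, ← mul_smul, this]
      · intro heq
        apply hf0
        have h3 : e * f = f := by
          apply FaithfulSMul.eq_of_smul_eq_smul (α := W)
          intro w
          have h4 : (Algebra.lsmul k k W f) w ∈ LinearMap.range (Algebra.lsmul k k W e) := by
            rw [heq]
            refine ⟨(Algebra.lsmul k k W f) w, ?_⟩
            have : (e + f) * f = f := by rw [add_mul, hef, hff, zero_add]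
            simp only [Algebra.lsmul_coe, ← mul_smul, this]
          obtain ⟨u, hu⟩ := h4
          simp only [Algebra.lsmul_coe] at hu
          rw [mul_smul, ← hu, ← mul_smul, hee]
        rw [← h3, hef]
    have := Submodule.finrank_lt_finrank_of_lt hlt
    exact absurd hle (not_le.2 this)
  -- e generates
  have htop : Submodule.span R (Set.range fun w : W => e • w) = ⊤ := by
    have : Module.Finite R W := Module.Finite.of_restrictScalars_finite k R W
    rcases eq_top_or_exists_le_coatom (Submodule.span R (Set.range fun w : W => e • w)) with h | h
    · exact h
    exfalso
    obtain ⟨M, hM, hle⟩ := h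
    have heM : ∀ w : W, e • w ∈ M := fun w => hle (Submodule.subset_span ⟨w, rfl⟩)
    apply hM.1
    apply hp
    intro i w
    by_contra hiw
    set y := (1 - e) * p i * (1 - e) with hy
    have hu : y • w ∉ M := by
      intro hu
      apply hiw
      have : p i • w = y • w + e • ((p i * (1 - e)) • w) + p i • (e • w) := by
        rw [← mul_smul, ← mul_smul, ← add_smul, ← add_smul]
        congr 1
        rw [hy]; noncomm_ring
      rw [this]
      exact M.add_mem (M.add_mem hu (heM _)) (M.smul_mem _ (heM _))
    have hsup : M ⊔ Submodule.span R {y • w} = ⊤ := by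
      apply hM.2
      refine lt_of_le_of_ne le_sup_left ?_
      intro h
      apply hu
      rw [h]
      exact Submodule.mem_sup_right (Submodule.mem_span_singleton_self _)
    have hw : w ∈ M ⊔ Submodule.span R {y • w} := hsup ▸ Submodule.mem_top
    obtain ⟨m, hm, u', hu', hmu⟩ := Submodule.mem_sup.1 hw
    obtain ⟨r, rfl⟩ := Submodule.mem_span_singleton.1 hu'
    set u := y • w with hudef
    set z := (1 - e) * (p i * (1 - e) * r) * (1 - e) with hz
    have hzn : IsNilpotent z := hnil _ (by
      rw [mul_assoc]; exact I_mul _ (I_p i) _)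
    have huz : u = z • u + y • m := by
      have h1 : (1 - e) * y = y := by
        rw [hy, ← mul_assoc, ← mul_assoc]
        congr 2
        rw [sub_mul, one_mul, mul_sub, mul_one, hee, sub_self, sub_zero]
      have h2 : z • u = (y * r) • u := by
        rw [hudef, ← mul_smul, ← mul_smul]
        congr 1
        calc z * y = (1 - e) * (p i * (1 - e) * r) * ((1 - e) * y) := by rw [hz, mul_assoc]
          _ = y * r * y := by rw [h1, hy]; noncomm_ring
      rw [h2, mul_smul, ← smul_add, add_comm, hmu]
    have hpow : ∀ j : ℕ, u - z ^ j • u ∈ M := by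
      intro j
      induction j with
      | zero => simp
      | succ j ih =>
        have : u - z ^ (j + 1) • u = y • m + z • (u - z ^ j • u) := by
          rw [smul_sub, ← mul_smul z (z ^ j), ← pow_succ']
          nth_rewrite 1 [huz]
          abel
        rw [this]
        exact M.add_mem (M.smul_mem _ hm) (M.smul_mem _ ih)
    obtain ⟨j, hj⟩ := hzn
    have := hpow j
    rw [hj, zero_smul, sub_zero] at this
    exact hu this
  have h1 : e = 1 := hmin e hei htop
  rw [h1] at heI
  exact heI

end LA
section AbsCat

variable {C : Type*} [Category C] [Abelian C]

def Hered (C : Type*) [Category C] [Abelian C] : Prop :=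
  ∀ (S : ShortComplex C), S.Exact → Epi S.g →
    ∃ (E : C) (j : S.X₁ ⟶ E) (e : E ⟶ S.X₂), j ≫ e = S.f ∧
      ∃ w : j ≫ (e ≫ S.g) = 0, (ShortComplex.mk j (e ≫ S.g) w).ShortExact

theorem hered_epi (S : ShortComplex C) (hS : S.Exact) (hg : Epi S.g) {E : C} (j : S.X₁ ⟶ E)
    (e : E ⟶ S.X₂) (hje : j ≫ e = S.f) (w : j ≫ (e ≫ S.g) = 0)
    (h : (ShortComplex.mk j (e ≫ S.g) w).ShortExact) : Epi e := by
  apply Preadditive.epi_of_cancel_zero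
  intro Z x hx
  have h1 : S.f ≫ x = 0 := by rw [← hje, Category.assoc, hx, comp_zero]
  have h2 : S.g ≫ hS.desc x h1 = x := hS.g_desc x h1
  have h3 : Epi (e ≫ S.g) := h.epi_g
  have h4 : hS.desc x h1 = 0 := by
    rw [← cancel_epi (e ≫ S.g), Category.assoc, h2, hx, comp_zero]
  rw [← h2, h4, comp_zero]

theorem summand_refl (X : C) : IsSummand X X := ⟨𝟙 X, 𝟙 X, by simp⟩

theorem summand_of_iso {X Y : C} (e : X ≅ Y) : IsSummand X Y := ⟨e.hom, e.inv, by simp⟩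

theorem IsSummand.trans' {X Y Z : C} (h : IsSummand X Y) (h' : IsSummand Y Z) : IsSummand X Z := by
  obtain ⟨i, r, h⟩ := h
  obtain ⟨i', r', h'⟩ := h'
  exact ⟨i ≫ i', r' ≫ r, by rw [Category.assoc, reassoc_of% h', h]⟩

theorem pbExact (S : ShortComplex C) (hS : S.Exact) {D : C} (d : D ⟶ S.X₃) :
    (ShortComplex.mk (pullback.lift (f := S.g) (g := d) S.f 0 (by rw [S.zero, zero_comp]))
      (pullback.snd S.g d) (pullback.lift_snd _ _ _)).Exact := by
  rw [ShortComplex.exact_iff_exact_up_to_refinements]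
  intro A x hx
  dsimp at x hx
  have h1 : (x ≫ pullback.fst S.g d) ≫ S.g = 0 := by
    rw [Category.assoc, pullback.condition, reassoc_of% hx, zero_comp]
  obtain ⟨A', π, hπ, y, hy⟩ := hS.exact_up_to_refinements _ h1
  refine ⟨A', π, hπ, y, ?_⟩
  dsimp
  apply pullback.hom_ext
  · rw [Category.assoc, Category.assoc, pullback.lift_fst, hy]
  · rw [Category.assoc, Category.assoc, pullback.lift_snd, hx, comp_zero, comp_zero]

theorem IsTorsionClass.ext' {T : Set C} (hT : IsTorsionClass T) (S : ShortComplex C)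
    (hS : S.Exact) (hg : Epi S.g) (h1 : S.X₁ ∈ T) (h3 : S.X₃ ∈ T) : S.X₂ ∈ T := by
  have he : Epi (kernel.lift S.g S.f S.zero) := S.exact_iff_epi_kernel_lift.1 hS
  have hk : kernel S.g ∈ T := hT.quot_mem _ h1 _ _ he
  refine hT.ext_mem (ShortComplex.mk (kernel.ι S.g) S.g (by simp)) ?_ hk h3
  exact { exact := ShortComplex.exact_kernel S.g, epi_g := hg }

theorem IsTorsionClass.pb {T : Set C} (hT : IsTorsionClass T) (S : ShortComplex C)
    (hS : S.Exact) (hg : Epi S.g) (h1 : S.X₁ ∈ T) {D : C} (hD : D ∈ T) (d : D ⟶ S.X₃) :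
    pullback S.g d ∈ T :=
  hT.ext' _ (pbExact S hS d) (by dsimp; infer_instance) h1 hD

theorem aSet_of_mono {T : Set C} (hT : IsTorsionClass T) {X B : C} (hX : X ∈ aSet T) (hB : B ∈ T)
    (i : B ⟶ X) [Mono i] : B ∈ aSet T := by
  refine ⟨hB, fun Y hY g => ?_⟩
  exact hT.summand_mem _ (hX.2 Y hY (g ≫ i)) _ (summand_of_iso (kernelCompMono g i).symm)

theorem aSet_ext {T : Set C} (hT : IsTorsionClass T) (S : ShortComplex C) (hS : S.ShortExact)
    (h1 : S.X₁ ∈ aSet T) (h3 : S.X₃ ∈ aSet T) : S.X₂ ∈ aSet T := by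
  refine ⟨hT.ext_mem S hS h1.1 h3.1, fun Y hY g => ?_⟩
  have := hS.mono_f
  have hK := h3.2 Y hY (g ≫ S.g)
  let φ : kernel (g ≫ S.g) ⟶ S.X₁ := hS.exact.lift (kernel.ι (g ≫ S.g) ≫ g) (by
    rw [Category.assoc, kernel.condition])
  have hφ : φ ≫ S.f = kernel.ι (g ≫ S.g) ≫ g := hS.exact.lift_f _ _
  refine hT.summand_mem _ (h1.2 _ hK φ) _ ⟨kernel.lift φ (kernel.lift (g ≫ S.g) (kernel.ι g)
    (by rw [← Category.assoc, kernel.condition, zero_comp])) ?_,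
    kernel.lift g (kernel.ι φ ≫ kernel.ι (g ≫ S.g)) ?_, ?_⟩
  · rw [← cancel_mono S.f, Category.assoc, hφ, kernel.lift_ι_assoc, kernel.condition, zero_comp]
  · rw [Category.assoc, ← hφ, ← Category.assoc, kernel.condition, zero_comp]
  · ext; simp

theorem sum_shortExact (X Y : C) :
    (ShortComplex.mk (biprod.inl : X ⟶ X ⊞ Y) biprod.snd (by simp)).ShortExact :=
  ShortComplex.Splitting.shortExact
    { r := biprod.fst
      s := biprod.inr
      f_r := by simp
      s_g := by simp
      id := by simp }

theorem aSet_wide {T : Set C} (hT : IsTorsionClass T) : IsWide (aSet T) where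
  zero_mem := ⟨hT.zero_mem, fun Y hY g =>
    hT.summand_mem _ hY _ ⟨kernel.ι g, kernel.lift g (𝟙 Y) ((isZero_zero C).eq_of_tgt _ _),
      by ext; simp⟩⟩
  sum_mem X hX Y hY := aSet_ext hT _ (sum_shortExact X Y) hX hY
  summand_mem X hX Y hY := by
    have hm := hT.summand_mem X hX.1 Y hY
    obtain ⟨i, r, h⟩ := hY
    have : Mono i := mono_of_mono_fac h
    exact aSet_of_mono hT hX hm i
  ker_mem X hX Y hY f := aSet_of_mono hT hX (hY.2 X hX.1 f) (kernel.ι f)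
  coker_mem X hX Y hY f := by
    refine ⟨hT.quot_mem _ hY.1 _ (cokernel.π f) inferInstance, fun Z hZ g => ?_⟩
    have hP : pullback (cokernel.π f) g ∈ T :=
      hT.pb (ShortComplex.mk f (cokernel.π f) (by simp)) (ShortComplex.exact_cokernel f)
        (by dsimp; infer_instance) hX.1 hZ g
    refine hT.summand_mem _ (hY.2 _ hP (pullback.fst _ _)) _
      ⟨kernel.lift _ (pullback.lift (f := cokernel.π f) (g := g) 0 (kernel.ι g)
        (by rw [kernel.condition, zero_comp])) (pullback.lift_fst _ _ _),
       kernel.lift g (kernel.ι _ ≫ pullback.snd _ _) ?_, ?_⟩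
    · rw [Category.assoc, ← pullback.condition, ← Category.assoc, kernel.condition, zero_comp]
    · rw [← cancel_mono (kernel.ι g), Category.assoc, kernel.lift_ι, kernel.lift_ι_assoc,
        pullback.lift_snd, Category.id_comp]
  ext_mem S hS h1 h3 := aSet_ext hT S hS h1 h3

theorem splitProj_mem_aSet (her : Hered C) {T : Set C} (hT : IsTorsionClass T) {P : C}
    (hP : SplitProjIn T P) : P ∈ aSet T := by
  refine ⟨hP.1, fun Y hY g => ?_⟩
  have hex := ShortComplex.exact_cokernel g
  have hepi : Epi (cokernel.π g) := inferInstance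
  obtain ⟨E, j, e, hje, w, hE⟩ := her (ShortComplex.mk g (cokernel.π g) (by simp)) hex hepi
  have hee := hered_epi _ hex hepi j e hje w hE
  dsimp at j e hje w hE
  have hET : E ∈ T := hT.ext_mem _ hE hY (hT.quot_mem _ hP.1 _ _ hepi)
  obtain ⟨s, hs⟩ := hP.2 E hET e hee
  have hj : Mono j := hE.mono_f
  have hc : (𝟙 E - e ≫ s) ≫ e = 0 := by simp [hs]
  have hc' : (𝟙 E - e ≫ s) ≫ (e ≫ cokernel.π g) = 0 := by rw [← Category.assoc, hc, zero_comp]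
  let l : E ⟶ Y := hE.exact.lift (𝟙 E - e ≫ s) hc'
  have hl : l ≫ j = 𝟙 E - e ≫ s := hE.exact.lift_f _ _
  refine hT.summand_mem _ hET _ ⟨kernel.ι g ≫ j, kernel.lift g l ?_, ?_⟩
  · rw [← hje, ← Category.assoc, hl, hc]
  · rw [← cancel_mono (kernel.ι g), ← cancel_mono j]
    simp [hl, reassoc_of% hje]

theorem splitProj_lift {T : Set C} (hT : IsTorsionClass T) {U X Z : C} (hU : SplitProjIn T U)
    (hX : X ∈ T) (hZ : Z ∈ aSet T) (q : X ⟶ Z) [Epi q] (f : U ⟶ Z) : ∃ l : U ⟶ X, l ≫ q = f := by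
  have hP : pullback q f ∈ T :=
      hT.pb (ShortComplex.mk (kernel.ι q) q (by simp)) (ShortComplex.exact_kernel q)
        (by dsimp; infer_instance) (hZ.2 X hX q) hU.1 f
  obtain ⟨s, hs⟩ := hU.2 _ hP (pullback.snd q f) inferInstance
  exact ⟨s ≫ pullback.fst q f, by rw [Category.assoc, pullback.condition, reassoc_of% hs]⟩

/-- closed under finite sums and summands -/
structure AddClosed (A : Set C) : Prop where
  zero_mem : (0 : C) ∈ A
  sum_mem : ∀ X ∈ A, ∀ Y ∈ A, (X ⊞ Y : C) ∈ A
  summand_mem : ∀ X ∈ A, ∀ Y : C, IsSummand Y X → Y ∈ A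

theorem IsWide.ac {A : Set C} (h : IsWide A) : AddClosed A := ⟨h.1, h.2, h.3⟩
theorem IsTorsionClass.ac {A : Set C} (h : IsTorsionClass A) : AddClosed A := ⟨h.1, h.2, h.3⟩

theorem AddClosed.biprod_mem {A : Set C} (h : AddClosed A) :
    ∀ (n : ℕ) (f : Fin n → C), (∀ i, f i ∈ A) → (⨁ f) ∈ A := by
  intro n
  induction n with
  | zero =>
    intro f _
    refine h.summand_mem _ h.zero_mem _ ⟨0, 0, ?_⟩
    apply biproduct.hom_ext
    intro j
    exact j.elim0
  | succ n ih =>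
    intro f hf
    refine h.summand_mem _ (h.sum_mem _ (hf 0) _ (ih (fun j => f j.succ) fun j => hf _)) _
      ⟨biprod.lift (biproduct.π f 0) (biproduct.lift fun j => biproduct.π f j.succ),
       biprod.desc (biproduct.ι f 0) (biproduct.desc fun j => biproduct.ι f j.succ), ?_⟩
    rw [biprod.lift_desc, biproduct.lift_desc, ← biproduct.total (f := f), Fin.sum_univ_succ]

theorem AddClosed.addSet_sub {A S : Set C} (h : AddClosed A) (hS : S ⊆ A) : addSet S ⊆ A := by
  rintro X ⟨n, f, hf, hX⟩
  exact h.summand_mem _ (h.biprod_mem n f fun i => hS (hf i)) _ hX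

theorem biprod_mem_addSet {ι : Type} [Fintype ι] {S : Set C} (f : ι → C) (hf : ∀ i, f i ∈ S) :
    (⨁ f) ∈ addSet S :=
  ⟨Fintype.card ι, f ∘ (Fintype.equivFin ι).symm, fun i => hf _,
    summand_of_iso (biproduct.reindex (Fintype.equivFin ι).symm f).symm⟩

theorem self_mem_addSet {S : Set C} {X : C} (hX : X ∈ S) : X ∈ addSet S := by
  refine ⟨1, fun _ => X, fun _ => hX, biproduct.ι (fun _ : Fin 1 => X) 0,
    biproduct.π (fun _ : Fin 1 => X) 0, by simp⟩

theorem sum_summand {n m : ℕ} (h : Fin n ⊕ Fin m → C) :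
    IsSummand ((⨁ fun j => h (Sum.inl j)) ⊞ (⨁ fun j => h (Sum.inr j))) (⨁ h) := by
  refine ⟨biprod.desc (biproduct.desc fun j => biproduct.ι h (Sum.inl j))
          (biproduct.desc fun j => biproduct.ι h (Sum.inr j)),
        biprod.lift (biproduct.lift fun j => biproduct.π h (Sum.inl j))
          (biproduct.lift fun j => biproduct.π h (Sum.inr j)), ?_⟩
  apply biprod.hom_ext' <;> apply biprod.hom_ext <;> apply biproduct.hom_ext' <;> intro a <;>
    apply biproduct.hom_ext <;> intro b
  · by_cases hab : a = b
    · subst hab; simp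
    · have : (Sum.inl a : Fin n ⊕ Fin m) ≠ Sum.inl b := by simpa using hab
      simp [biproduct.ι_π_ne _ hab, biproduct.ι_π_ne _ this]
  · have : (Sum.inl a : Fin n ⊕ Fin m) ≠ Sum.inr b := by simp
    simp [biproduct.ι_π_ne _ this]
  · have : (Sum.inr a : Fin n ⊕ Fin m) ≠ Sum.inl b := by simp
    simp [biproduct.ι_π_ne _ this]
  · by_cases hab : a = b
    · subst hab; simp
    · have : (Sum.inr a : Fin n ⊕ Fin m) ≠ Sum.inr b := by simpa using hab
      simp [biproduct.ι_π_ne _ hab, biproduct.ι_π_ne _ this]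

theorem addSet_ac (S : Set C) : AddClosed (addSet S) where
  zero_mem := ⟨0, fun i => i.elim0, fun i => i.elim0, 0, 0, (isZero_zero C).eq_of_src _ _⟩
  sum_mem := by
    rintro X ⟨n, f, hf, i, r, hir⟩ Y ⟨m, g, hg, i', r', hir'⟩
    obtain ⟨N, F, hF, hs⟩ := biprod_mem_addSet (S := S) (Sum.elim f g : Fin n ⊕ Fin m → C)
      (by rintro (a | b); exacts [hf a, hg b])
    refine ⟨N, F, hF, IsSummand.trans' (Y := (⨁ f) ⊞ (⨁ g)) ?_ (IsSummand.trans' ?_ hs)⟩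
    · exact ⟨biprod.map i i', biprod.map r r', by ext <;> simp [hir, hir']⟩
    · exact sum_summand (Sum.elim f g : Fin n ⊕ Fin m → C)
  summand_mem := by
    rintro X ⟨n, f, hf, hX⟩ Y hY
    exact ⟨n, f, hf, hY.trans' hX⟩

theorem gen_quot {S : Set C} {X Y : C} (hX : X ∈ gen S) (p : X ⟶ Y) [Epi p] : Y ∈ gen S := by
  obtain ⟨A, hA, q, hq⟩ := hX
  exact ⟨A, hA, q ≫ p, epi_comp _ _⟩

theorem gen_ac (S : Set C) : AddClosed (gen S) where
  zero_mem := ⟨0, (addSet_ac S).zero_mem, 𝟙 _, inferInstance⟩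
  sum_mem := by
    rintro X ⟨A, hA, p, hp⟩ Y ⟨B, hB, q, hq⟩
    exact ⟨A ⊞ B, (addSet_ac S).sum_mem _ hA _ hB, biprod.map p q, inferInstance⟩
  summand_mem := by
    rintro X hX Y ⟨i, r, h⟩
    have : Epi r := epi_of_epi_fac h
    exact gen_quot hX r

theorem sub_gen (S : Set C) : S ⊆ gen S := fun X hX => ⟨X, self_mem_addSet hX, 𝟙 X, inferInstance⟩

theorem gen_sub {S T : Set C} (h : S ⊆ gen T) : gen S ⊆ gen T := by
  rintro X ⟨A, hA, p, hp⟩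
  exact gen_quot ((gen_ac T).addSet_sub h hA) p

theorem AddClosed.mem_gen {A : Set C} (h : AddClosed A) {X : C} (hX : X ∈ gen A) :
    ∃ D ∈ A, ∃ p : D ⟶ X, Epi p := by
  obtain ⟨D, hD, p, hp⟩ := hX
  exact ⟨D, h.addSet_sub subset_rfl hD, p, hp⟩

theorem gen_single {U X : C} (hX : X ∈ gen {U}) :
    ∃ (n : ℕ) (p : (⨁ fun _ : Fin n => U) ⟶ X), Epi p := by
  obtain ⟨A, ⟨n, f, hf, i, r, hir⟩, p, hp⟩ := hX
  obtain rfl : f = fun _ => U := funext hf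
  have : Epi r := epi_of_epi_fac hir
  exact ⟨n, r ≫ p, epi_comp _ _⟩

theorem part1 (her : Hered C) {T : Set C} (hT : IsTorsionClass T) {U : C} (hU : SplitProjIn T U)
    (hgen : T ⊆ gen {U}) :
    IsWide (aSet T) ∧ IsFinGen (aSet T) ∧ gen (aSet T) = T ∧
      (∀ P : C, SplitProjIn (aSet T) P ↔ SplitProjIn T P) := by
  have hUa := splitProj_mem_aSet her hT hU
  have haT : aSet T ⊆ T := fun X hX => hX.1
  refine ⟨aSet_wide hT, ⟨U, hUa, haT.trans hgen⟩, ?_, ?_⟩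
  · apply Set.Subset.antisymm
    · intro X hX
      obtain ⟨D, hD, p, hp⟩ := (aSet_wide hT).ac.mem_gen hX
      exact hT.quot_mem _ hD.1 _ p hp
    · refine hgen.trans (gen_sub ?_)
      rintro _ rfl
      exact sub_gen _ hUa
  · intro P
    constructor
    · rintro ⟨hPa, hPs⟩
      refine ⟨hPa.1, fun X hX q hq => ?_⟩
      obtain ⟨n, p, hp⟩ := gen_single (hgen hPa.1)
      obtain ⟨s, hs⟩ := hPs _ ((aSet_wide hT).ac.biprod_mem n _ fun _ => hUa) p hp
      choose l hl using fun i : Fin n =>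
        splitProj_lift hT hU hX hPa q (biproduct.ι (fun _ : Fin n => U) i ≫ p)
      refine ⟨s ≫ biproduct.desc l, ?_⟩
      have : biproduct.desc l ≫ q = p := by
        apply biproduct.hom_ext'
        intro i
        rw [biproduct.ι_desc_assoc, hl]
      rw [Category.assoc, this, hs]
    · intro hP
      exact ⟨splitProj_mem_aSet her hT hP, fun X hX => hP.2 X hX.1⟩

theorem part2 (her : Hered C) {A : Set C} (hA : IsWide A) (hfg : IsFinGen A) :
    IsTorsionClass (gen A) ∧ IsFinGen (gen A) ∧ aSet (gen A) = A := by
  have hac := hA.ac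
  refine ⟨⟨(gen_ac A).1, (gen_ac A).2, (gen_ac A).3, fun X hX Y p hp => gen_quot hX p, ?_⟩, ?_, ?_⟩
  · intro S hS h1 h3
    obtain ⟨B, hB, b, hb⟩ := hac.mem_gen h1
    obtain ⟨D, hD, d, hd⟩ := hac.mem_gen h3
    have := hS.epi_g
    have hex : (ShortComplex.mk (b ≫ S.f) S.g (by simp)).Exact := by
      rw [ShortComplex.exact_iff_exact_up_to_refinements]
      intro Z x hx
      dsimp at x hx
      obtain ⟨Z', π, hπ, y, hy⟩ := hS.exact.exact_up_to_refinements x hx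
      refine ⟨pullback y b, pullback.fst y b ≫ π, epi_comp _ _, pullback.snd y b, ?_⟩
      dsimp
      rw [Category.assoc, hy, ← pullback.condition_assoc]
    have hex2 := pbExact _ hex d
    have hepi2 : Epi (pullback.snd S.g d) := inferInstance
    obtain ⟨E, j, e, hje, w, hE⟩ := her _ hex2 hepi2
    have hee := hered_epi _ hex2 hepi2 j e hje w hE
    have hEA : E ∈ A := hA.ext_mem _ hE hB hD
    dsimp at e hee
    have : Epi (pullback.fst S.g d) := inferInstance
    exact gen_quot (sub_gen _ hEA) (e ≫ pullback.fst S.g d)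
  · obtain ⟨U, hU, h⟩ := hfg
    exact ⟨U, sub_gen _ hU, gen_sub h⟩
  · apply Set.Subset.antisymm
    · rintro B ⟨hB, hk⟩
      obtain ⟨D, hD, p, hp⟩ := hac.mem_gen hB
      obtain ⟨D', hD', q, hq⟩ := hac.mem_gen (hk D (sub_gen _ hD) p)
      refine hac.summand_mem _ (hA.coker_mem _ hD' _ hD (q ≫ kernel.ι p)) _ ?_
      have hex : (ShortComplex.mk (kernel.ι p) p (by simp)).Exact := ShortComplex.exact_kernel p
      have h0 : kernel.ι p ≫ cokernel.π (q ≫ kernel.ι p) = 0 := by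
        rw [← cancel_epi q, ← Category.assoc, cokernel.condition, comp_zero]
      have hp' : Epi (ShortComplex.mk (kernel.ι p) p (by simp)).g := hp
      refine ⟨hex.desc (cokernel.π (q ≫ kernel.ι p)) h0, cokernel.desc _ p (by simp), ?_⟩
      rw [← cancel_epi p]
      have := hex.g_desc (cokernel.π (q ≫ kernel.ι p)) h0
      dsimp at this
      rw [reassoc_of% this]
      simp
    · intro B hB
      refine ⟨sub_gen _ hB, fun Y hY g => ?_⟩
      obtain ⟨D, hD, p, hp⟩ := hac.mem_gen hY
      let t : kernel (p ≫ g) ⟶ kernel g := kernel.lift g (kernel.ι (p ≫ g) ≫ p) (by simp)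
      have ht : Epi t := by
        have : IsPullback t (kernel.ι (p ≫ g)) (kernel.ι g) p := by
          refine IsPullback.of_isLimit' ⟨by simp [t]⟩ (PullbackCone.IsLimit.mk _
            (fun s => kernel.lift _ s.snd (by rw [← Category.assoc, ← s.condition]; simp)) ?_ ?_ ?_)
          · intro s; ext; simp [t, s.condition]
          · intro s; simp
          · intro s m h1 h2; ext; simpa using h2
        exact MorphismProperty.of_isPullback (P := .epimorphisms C) this.flip hp
      exact gen_quot (sub_gen _ (hA.ker_mem _ hD _ hB (p ≫ g))) t

end AbsCat
section Her

variable {k : Type} [Field k] {Q : FinQuiver}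

theorem ptExact {S : ShortComplex (RepC k Q)} (hS : S.Exact) (v : Paths Q.V)
    (x : S.X₂.obj v) (hx : (S.g.app v).hom x = 0) : ∃ y, (S.f.app v).hom y = x := by
  have h := hS.map ((evaluation (Paths Q.V) (ModuleCat.{0} k)).obj v)
  rw [ShortComplex.moduleCat_exact_iff] at h
  exact h x hx

theorem exact_of_pt {S : ShortComplex (RepC k Q)} (hS : ∀ (v : Paths Q.V)
    (x : S.X₂.obj v) (_ : (S.g.app v).hom x = 0), ∃ y, (S.f.app v).hom y = x) : S.Exact := by
  rw [ShortComplex.exact_iff_isZero_homology]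
  rw [Functor.isZero_iff]
  intro v
  have h : (S.map ((evaluation (Paths Q.V) (ModuleCat.{0} k)).obj v)).Exact := by
    rw [ShortComplex.moduleCat_exact_iff]
    exact hS v
  rw [ShortComplex.exact_iff_isZero_homology] at h
  exact h.of_iso (S.mapHomologyIso ((evaluation (Paths Q.V) (ModuleCat.{0} k)).obj v)).symm

theorem epi_pt {X Y : RepC k Q} (f : X ⟶ Y) : Epi f ↔
    ∀ v : Paths Q.V, Function.Surjective (f.app v).hom := by
  rw [NatTrans.epi_iff_epi_app]
  simp only [ModuleCat.epi_iff_surjective]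

theorem mono_pt {X Y : RepC k Q} (f : X ⟶ Y) : Mono f ↔
    ∀ v : Paths Q.V, Function.Injective (f.app v).hom := by
  rw [NatTrans.mono_iff_mono_app]
  simp only [ModuleCat.mono_iff_injective]

theorem exists_pinv {A B : Type} [AddCommGroup A] [Module k A] [AddCommGroup B] [Module k B]
    (g : A →ₗ[k] B) : ∃ t : B →ₗ[k] A, ∀ x, g (t (g x)) = g x := by
  obtain ⟨s, hs⟩ := g.rangeRestrict.exists_rightInverse_of_surjective g.range_rangeRestrict
  obtain ⟨t, ht⟩ := s.exists_extend
  refine ⟨t, fun x => ?_⟩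
  have h1 : t (g x) = s ⟨g x, x, rfl⟩ := LinearMap.congr_fun ht ⟨g x, x, rfl⟩
  have h2 := LinearMap.congr_fun hs ⟨g x, x, rfl⟩
  rw [h1]
  exact congrArg Subtype.val h2

theorem natOfArrows {F G : RepC k Q} (α : ∀ v : Paths Q.V, F.obj v ⟶ G.obj v)
    (h : ∀ {v w : Q.V} (a : v ⟶ w), F.map ((Paths.of Q.V).map a) ≫ α ((Paths.of Q.V).obj w) =
      α ((Paths.of Q.V).obj v) ≫ G.map ((Paths.of Q.V).map a))
    {x y : Paths Q.V} (f : x ⟶ y) : F.map f ≫ α y = α x ≫ G.map f := by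
  refine Paths.induction (P := fun {x y} f => F.map f ≫ α y = α x ≫ G.map f) ?_ ?_ f
  · intro v
    simp
  · intro u v w p q hp
    rw [F.map_comp, G.map_comp, Category.assoc, h, ← Category.assoc, hp, Category.assoc]

theorem her_rep : Hered (RepC k Q) := by
  intro S hS hg
  have hsurj := (epi_pt S.g).1 hg
  choose s hs using fun v : Paths Q.V =>
    (S.g.app v).hom.exists_rightInverse_of_surjective (LinearMap.range_eq_top.2 (hsurj v))
  have hs' : ∀ v z, (S.g.app v).hom (s v z) = z := fun v z => LinearMap.congr_fun (hs v) z
  choose t ht using fun v : Paths Q.V => exists_pinv (S.f.app v).hom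
  have ht' : ∀ v x, (S.g.app v).hom x = 0 → (S.f.app v).hom (t v x) = x := by
    intro v x hx
    obtain ⟨y, rfl⟩ := ptExact hS v x hx
    exact ht v y
  have hfg : ∀ v x, (S.g.app v).hom ((S.f.app v).hom x) = 0 := by
    intro v x
    have := congrArg (fun φ => (φ.app v).hom x) S.zero
    exact this
  have nat1 : ∀ {v w : Paths Q.V} (a : v ⟶ w) x,
      (S.f.app w).hom ((S.X₁.map a).hom x) = (S.X₂.map a).hom ((S.f.app v).hom x) := by
    intro v w a x
    exact LinearMap.congr_fun (congrArg ModuleCat.Hom.hom (S.f.naturality a)) x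
  have nat2 : ∀ {v w : Paths Q.V} (a : v ⟶ w) x,
      (S.g.app w).hom ((S.X₂.map a).hom x) = (S.X₃.map a).hom ((S.g.app v).hom x) := by
    intro v w a x
    exact LinearMap.congr_fun (congrArg ModuleCat.Hom.hom (S.g.naturality a)) x
  have key : ∀ {v w : Paths Q.V} (a : v ⟶ w) (y : S.X₁.obj v) (z : S.X₃.obj v),
      (S.f.app w).hom ((S.X₁.map a).hom y +
        t w ((S.X₂.map a).hom (s v z) - s w ((S.X₃.map a).hom z))) +
        s w ((S.X₃.map a).hom z) = (S.X₂.map a).hom ((S.f.app v).hom y + s v z) := by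
    intro v w a y z
    rw [map_add, map_add, ht', nat1]
    · abel
    · rw [map_sub, nat2, hs', hs', sub_self]
  let m : ∀ {v w : Paths Q.V} (a : v ⟶ w),
      (S.X₁.obj v × S.X₃.obj v) →ₗ[k] (S.X₁.obj w × S.X₃.obj w) := fun {v w} a =>
    LinearMap.prod
      ((S.X₁.map a).hom ∘ₗ LinearMap.fst k _ _ +
        (t w ∘ₗ ((S.X₂.map a).hom ∘ₗ s v - s w ∘ₗ (S.X₃.map a).hom)) ∘ₗ LinearMap.snd k _ _)
      ((S.X₃.map a).hom ∘ₗ LinearMap.snd k _ _)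
  have hm : ∀ {v w : Paths Q.V} (a : v ⟶ w) y z, m a (y, z) =
    ((S.X₁.map a).hom y + t w ((S.X₂.map a).hom (s v z) - s w ((S.X₃.map a).hom z)),
      (S.X₃.map a).hom z) := fun a y z => rfl
  let φ : Q.V ⥤q ModuleCat.{0} k :=
    { obj := fun v => ModuleCat.of k (S.X₁.obj ((Paths.of Q.V).obj v) × S.X₃.obj ((Paths.of Q.V).obj v))
      map := fun a => ModuleCat.ofHom (m ((Paths.of Q.V).map a)) }
  let E : RepC k Q := Paths.lift φ
  have hE : ∀ {v w : Q.V} (a : v ⟶ w), E.map ((Paths.of Q.V).map a) =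
      ModuleCat.ofHom (m ((Paths.of Q.V).map a)) := fun a => Paths.lift_toPath φ a
  let jv : ∀ v : Paths Q.V, S.X₁.obj v ⟶ E.obj v := fun v =>
    ModuleCat.ofHom (LinearMap.inl k (S.X₁.obj v) (S.X₃.obj v))
  let ev : ∀ v : Paths Q.V, E.obj v ⟶ S.X₂.obj v := fun v =>
    ModuleCat.ofHom (LinearMap.coprod (S.f.app v).hom (s v) :
      (S.X₁.obj v × S.X₃.obj v) →ₗ[k] S.X₂.obj v)
  let j : S.X₁ ⟶ E :=
    { app := jv
      naturality := fun x y f => natOfArrows jv (by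
        intro v w a
        rw [hE]
        apply ModuleCat.hom_ext
        apply LinearMap.ext
        intro y
        change ((S.X₁.map ((Paths.of Q.V).map a)).hom y, (0 : S.X₃.obj ((Paths.of Q.V).obj w))) =
          m ((Paths.of Q.V).map a) (y, 0)
        rw [hm]
        simp) f }
  let e : E ⟶ S.X₂ :=
    { app := ev
      naturality := fun x y f => natOfArrows ev (by
        intro v w a
        rw [hE]
        apply ModuleCat.hom_ext
        apply LinearMap.ext
        rintro ⟨y, z⟩
        exact key ((Paths.of Q.V).map a) y z) f }
  have hje : j ≫ e = S.f := by
    apply NatTrans.ext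
    funext v
    apply ModuleCat.hom_ext
    apply LinearMap.ext
    intro y
    have h0 : (S.f.app v).hom y + s v 0 = (S.f.app v).hom y := by rw [map_zero, add_zero]
    exact h0
  have heg : ∀ (v : Paths Q.V) (y : S.X₁.obj v) (z : S.X₃.obj v),
      ((e ≫ S.g).app v).hom (y, z) = z := by
    intro v y z
    have h0 : (S.g.app v).hom ((S.f.app v).hom y + s v z) = z := by
      rw [map_add, hfg, hs', zero_add]
    exact h0
  have w : j ≫ (e ≫ S.g) = 0 := by rw [← Category.assoc, hje, S.zero]
  refine ⟨E, j, e, hje, w, ?_⟩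
  refine { exact := exact_of_pt ?_, mono_f := (mono_pt _).2 ?_, epi_g := (epi_pt _).2 ?_ }
  · rintro v ⟨y, z⟩ hx
    refine ⟨y, ?_⟩
    have hz : z = 0 := (heg v y z).symm.trans hx
    subst hz
    rfl
  · intro v y y' h
    exact congrArg Prod.fst h
  · intro v z
    exact ⟨((0 : S.X₁.obj v), z), heg v 0 z⟩

end Her

section SplitGen

variable {k : Type} [Field k] {Q : FinQuiver}

instance fintypePaths : Fintype (Paths Q.V) := inferInstanceAs (Fintype Q.V)

theorem FinDim.fd {X : RepC k Q} (h : FinDim X) (v : Paths Q.V) :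
    Module.Finite k (X.obj v) := h v

def tdim (X : RepC k Q) : ℕ := ∑ v : Paths Q.V, Module.finrank k (X.obj v)

def homToPi (X Y : RepC k Q) : (X ⟶ Y) →ₗ[k] (∀ v : Paths Q.V, X.obj v →ₗ[k] Y.obj v) where
  toFun f v := (f.app v).hom
  map_add' f g := rfl
  map_smul' c f := rfl

theorem homToPi_inj (X Y : RepC k Q) : Function.Injective (homToPi X Y) := by
  intro f g h
  apply NatTrans.ext
  funext v
  exact ModuleCat.hom_ext (congrFun h v)

theorem hom_finite {X Y : RepC k Q} (hX : FinDim X) (hY : FinDim Y) : Module.Finite k (X ⟶ Y) := by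
  have := hX.fd
  have := hY.fd
  exact Module.Finite.of_injective (homToPi X Y) (homToPi_inj X Y)

def TotSp (U : RepC k Q) : Type := ∀ v : Paths Q.V, U.obj v

instance (U : RepC k Q) : AddCommGroup (TotSp U) :=
  inferInstanceAs (AddCommGroup (∀ v : Paths Q.V, U.obj v))

instance (U : RepC k Q) : Module k (TotSp U) :=
  inferInstanceAs (Module k (∀ v : Paths Q.V, U.obj v))

theorem totSp_finite {U : RepC k Q} (hU : FinDim U) : Module.Finite k (TotSp U) := by
  have := hU.fd
  exact inferInstanceAs (Module.Finite k (∀ v : Paths Q.V, U.obj v))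

instance totMod (U : RepC k Q) : Module (End U) (TotSp U) where
  smul φ w := fun v => (NatTrans.app φ v).hom (w v)
  one_smul w := rfl
  mul_smul φ ψ w := rfl
  smul_zero φ := funext fun v => map_zero (NatTrans.app φ v).hom
  smul_add φ w w' := funext fun v => map_add (NatTrans.app φ v).hom (w v) (w' v)
  add_smul φ ψ w := rfl
  zero_smul w := rfl

theorem tot_smul {U : RepC k Q} (φ : End U) (w : TotSp U) (v : Paths Q.V) :
    (φ • w) v = (NatTrans.app φ v).hom (w v) := rfl

instance (U : RepC k Q) : IsScalarTower k (End U) (TotSp U) where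
  smul_assoc c φ w := rfl

open scoped Classical in
def totSingle (U : RepC k Q) (v : Paths Q.V) (x : U.obj v) : TotSp U :=
  (Pi.single v x : ∀ v : Paths Q.V, U.obj v)

theorem totSingle_same (U : RepC k Q) (v : Paths Q.V) (x : U.obj v) : totSingle U v x v = x := by
  classical
  exact Pi.single_eq_same (M := fun v : Paths Q.V => U.obj v) v x

instance (U : RepC k Q) : FaithfulSMul (End U) (TotSp U) where
  eq_of_smul_eq_smul {φ ψ} h := by
    apply NatTrans.ext
    funext v
    apply ModuleCat.hom_ext
    apply LinearMap.ext
    intro x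
    have h1 := congrFun (h (totSingle U v x)) v
    rw [tot_smul, tot_smul, totSingle_same] at h1
    exact h1

def evTot (U : RepC k Q) (v : Paths Q.V) : TotSp U →ₗ[k] U.obj v where
  toFun w := w v
  map_add' _ _ := rfl
  map_smul' _ _ := rfl

theorem biprod_sum {n : ℕ} {U Z : RepC k Q} (P : (⨁ fun _ : Fin n => U) ⟶ Z) (v : Paths Q.V)
    (y : (⨁ fun _ : Fin n => U : RepC k Q).obj v) :
    (P.app v).hom y = ∑ i, ((biproduct.ι (fun _ : Fin n => U) i ≫ P).app v).hom
      (((biproduct.π (fun _ : Fin n => U) i).app v).hom y) := by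
  have h : P = ∑ i, biproduct.π (fun _ : Fin n => U) i ≫ biproduct.ι (fun _ : Fin n => U) i ≫ P := by
    simp only [← Category.assoc]
    rw [← Preadditive.sum_comp, biproduct.total, Category.id_comp]
  have h2 := congrArg (fun f => homToPi _ _ f v y) h
  simp only [map_sum, Finset.sum_apply, LinearMap.sum_apply] at h2
  exact h2

theorem gen_of_span {U Y : RepC k Q} (hU : FinDim U) (hY : FinDim Y) (r : U ⟶ Y) (i : Y ⟶ U)
    (e : End U) (he : r ≫ i = e)
    (hs : Submodule.span (End U) (Set.range fun w : TotSp U => e • w) = ⊤) : U ∈ gen {Y} := by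
  have := hom_finite hY hU
  obtain ⟨n, s, hspan⟩ := Module.Finite.exists_fin (R := k) (M := (Y ⟶ U))
  let D : (⨁ fun _ : Fin n => Y) ⟶ U := biproduct.desc s
  have fac : ∀ ψ : Y ⟶ U, ∃ h : Y ⟶ ⨁ fun _ : Fin n => Y, h ≫ D = ψ := by
    intro ψ
    have hψ : ψ ∈ Submodule.span k (Set.range s) := hspan ▸ Submodule.mem_top
    induction hψ using Submodule.span_induction with
    | mem x hx =>
      obtain ⟨j, rfl⟩ := hx
      exact ⟨biproduct.ι (fun _ : Fin n => Y) j, biproduct.ι_desc s j⟩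
    | zero => exact ⟨0, zero_comp⟩
    | add x y _ _ hx hy =>
      obtain ⟨a, rfl⟩ := hx
      obtain ⟨b, rfl⟩ := hy
      exact ⟨a + b, Preadditive.add_comp _ _ _ _ _ _⟩
    | smul c x _ hx =>
      obtain ⟨a, rfl⟩ := hx
      exact ⟨c • a, Linear.smul_comp _ _ _ _ _ _⟩
  let M : Submodule (End U) (TotSp U) :=
    { carrier := {w | ∀ v, ∃ y, (D.app v).hom y = w v}
      zero_mem' := fun v => ⟨0, map_zero _⟩
      add_mem' := by
        intro a b ha hb v
        obtain ⟨y, hy⟩ := ha v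
        obtain ⟨z, hz⟩ := hb v
        exact ⟨y + z, by rw [map_add, hy, hz]; rfl⟩
      smul_mem' := by
        intro φ w hw v
        obtain ⟨y, hy⟩ := hw v
        choose h hh using fun j : Fin n => fac (s j ≫ φ)
        have hD : biproduct.desc h ≫ D = D ≫ φ := by
          apply biproduct.hom_ext'
          intro j
          rw [biproduct.ι_desc_assoc, hh, biproduct.ι_desc_assoc]
        refine ⟨((biproduct.desc h).app v).hom y, ?_⟩
        rw [tot_smul, ← hy]
        exact congrArg (fun f => homToPi _ _ f v y) hD }
  have hM : M = ⊤ := by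
    rw [eq_top_iff, ← hs, Submodule.span_le]
    rintro _ ⟨w, rfl⟩ v
    obtain ⟨h, hh⟩ := fac i
    refine ⟨((r ≫ h).app v).hom (w v), ?_⟩
    have h1 : (r ≫ h) ≫ D = e := by rw [Category.assoc, hh, he]
    exact congrArg (fun f => homToPi U U f v (w v)) h1
  refine ⟨_, biprod_mem_addSet (fun _ : Fin n => Y) (fun _ => rfl), D, (epi_pt D).2 ?_⟩
  intro v x
  have hx : totSingle U v x ∈ M := hM ▸ Submodule.mem_top
  obtain ⟨y, hy⟩ := hx v
  exact ⟨y, hy.trans (totSingle_same U v x)⟩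

theorem epi_of_tdim {U Y : RepC k Q} (hU : FinDim U) (hY : FinDim Y) (r : U ⟶ Y) (i : Y ⟶ U)
    (hir : i ≫ r = 𝟙 Y) (hd : tdim U ≤ tdim Y) : Epi i := by
  have := hU.fd
  have := hY.fd
  have hinj : ∀ v, Function.Injective (i.app v).hom := by
    have : Mono i := mono_of_mono_fac hir
    exact (mono_pt i).1 this
  have hle : ∀ v ∈ (Finset.univ : Finset (Paths Q.V)),
      Module.finrank k (Y.obj v) ≤ Module.finrank k (U.obj v) := fun v _ =>
    LinearMap.finrank_le_finrank_of_injective (hinj v)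
  have heq : ∀ v ∈ (Finset.univ : Finset (Paths Q.V)),
      Module.finrank k (Y.obj v) = Module.finrank k (U.obj v) :=
    (Finset.sum_eq_sum_iff_of_le hle).1 (le_antisymm (Finset.sum_le_sum hle) hd)
  rw [epi_pt]
  intro v
  exact (LinearMap.injective_iff_surjective_of_finrank_eq_finrank (heq v (Finset.mem_univ v))).1
    (hinj v)

theorem exists_splitGen {T : Set (RepC k Q)} (hT : IsTorsionClass T) (hfd : ∀ X ∈ T, FinDim X)
    (hfg : IsFinGen T) : ∃ U, SplitProjIn T U ∧ T ⊆ gen {U} := by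
  obtain ⟨U₀, hU₀⟩ := hfg
  obtain ⟨U, ⟨hUT, hUg⟩, hmin⟩ :=
    (InvImage.wf (tdim (k := k) (Q := Q)) Nat.lt_wfRel.wf).has_min {U | U ∈ T ∧ T ⊆ gen {U}}
      ⟨U₀, hU₀⟩
  refine ⟨U, ⟨hUT, ?_⟩, hUg⟩
  intro X hX q hq
  have hUd := hfd U hUT
  obtain ⟨n, P, hP⟩ := gen_single (hUg hX)
  have := totSp_finite hUd
  have : Module.Finite k (End U) := hom_finite hUd hUd
  let p : Fin n → End U := fun i => biproduct.ι (fun _ : Fin n => U) i ≫ P ≫ q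
  have hla := la_main (k := k) (W := TotSp U) (End U) n p
  have hla2 := hla ?_ ?_
  · obtain ⟨r, hr⟩ := hla2
    refine ⟨(biproduct.lift (fun i => (r i : U ⟶ U)) : U ⟶ ⨁ fun _ : Fin n => U) ≫ P, ?_⟩
    have h1 : (biproduct.lift (fun i => (r i : U ⟶ U)) : U ⟶ ⨁ fun _ : Fin n => U) =
        ∑ i, (r i : U ⟶ U) ≫ biproduct.ι (fun _ : Fin n => U) i := biproduct.lift_eq
    rw [h1, Category.assoc, Preadditive.sum_comp]
    simp only [Category.assoc]
    exact hr
  · intro M hM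
    rw [eq_top_iff]
    intro w _
    have hsurj := (epi_pt (P ≫ q)).1 (epi_comp P q)
    choose y hy using fun v => hsurj v (w v)
    let z : Fin n → TotSp U := fun i v => ((biproduct.π (fun _ : Fin n => U) i).app v).hom (y v)
    have hw : w = ∑ i, p i • z i := by
      funext v
      rw [← hy v, biprod_sum]
      exact (map_sum (evTot U v) (fun i => p i • z i) Finset.univ).symm
    rw [hw]
    exact Submodule.sum_mem _ fun i _ => hM i (z i)
  · intro e he hs
    obtain ⟨Y, i, r, hir, hri⟩ := IsIdempotentComplete.idempotents_split U e he
    have hYT : Y ∈ T := hT.summand_mem U hUT Y ⟨i, r, hir⟩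
    have hYd := hfd Y hYT
    have hUY : U ∈ gen {Y} := gen_of_span hUd hYd r i e hri hs
    have hYg : T ⊆ gen {Y} := fun Z hZ => gen_sub (by rintro _ rfl; exact hUY) (hUg hZ)
    have hd : tdim U ≤ tdim Y := not_lt.1 (hmin Y ⟨hYT, hYg⟩)
    have hepi := epi_of_tdim hUd hYd r i hir hd
    change e = 𝟙 U
    rw [← cancel_epi i, ← hri, ← Category.assoc, hir, Category.id_comp, Category.comp_id]

end SplitGen

section Statement7

/-- If `T` is a finitely generated torsion class in `rep Q`, then
`a(T)` is a finitely generated wide subcategory, `Gen a(T) = T`, and the projective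
objects of the abelian category `a(T)` are exactly the `T`-split projective objects.
Consequently `T ↦ a(T)` and `A ↦ Gen A` are mutually inverse bijections between
finitely generated torsion classes in `rep Q` and finitely generated wide
subcategories of `rep Q`. -/
theorem statement7 (k : Type) [Field k] [IsAlgClosed k] (Q : FinQuiver) :
    (∀ T : Set (RepC k Q), IsTorsionClass T → (∀ X ∈ T, FinDim X) → IsFinGen T →
      IsWide (aSet T) ∧ IsFinGen (aSet T) ∧ gen (aSet T) = T ∧
      (∀ P : RepC k Q, SplitProjIn (aSet T) P ↔ SplitProjIn T P)) ∧
    (∀ A : Set (RepC k Q), IsWide A → (∀ X ∈ A, FinDim X) → IsFinGen A →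
      IsTorsionClass (gen A) ∧ IsFinGen (gen A) ∧ aSet (gen A) = A) := by
  refine ⟨fun T hT hfd hfg => ?_, fun A hA _ hfg => part2 her_rep hA hfg⟩
  obtain ⟨U, hU, hg⟩ := exists_splitGen hT hfd hfg
  exact part1 her_rep hT hU hg

end Statement7
end NCPaper
end
end
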